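/- arXiv:2202.06359 — 10 statements merged into one kernel-verified Lean document; each statement's English description precedes it below -/
import Mathlib

section
/- Let σ_c > 0, δ_c > 0, a > 0, and ρ > a σ_c/δ_c. Then for any p, c ∈ ℝ, the function g(t) = a φ_c(t) − p t + (ρ/2)(t − c)² is strongly convex on the interval [0, ∞) with strong convexity parameter ρ − a σ_c/δ_c. -/
/-- The linearly decaying cohesive potential. -/
noncomputable def phic (σc δc t : ℝ) : ℝ :=
  if t ≤ δc then σc * t - σc * t ^ 2 / (2 * δc) else σc * δc / 2

/-- The convex part `max (t - δ) 0 ^ 2`. -/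
theorem aux_convex (δ : ℝ) : ConvexOn ℝ (Set.Ici (0 : ℝ)) (fun t : ℝ => (max (t - δ) 0) ^ 2) := by
  have h1 : ConvexOn ℝ (Set.Ici (0 : ℝ)) (fun t : ℝ => max (t - δ) 0) := by
    have h2 : ConvexOn ℝ (Set.Ici (0 : ℝ)) (fun t : ℝ => t - δ) := by
      refine ⟨convex_Ici 0, fun x _ y _ u v _ _ huv => ?_⟩
      simp only [smul_eq_mul]
      have : v = 1 - u := by linarith
      subst this
      apply le_of_eq
      ring
    exact h2.sup (convexOn_const 0 (convex_Ici 0))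
  exact h1.pow (fun x _ => le_max_right _ _) 2

/-- the scalar crack-opening objective is strongly convex on `[0, ∞)`
with parameter `ρ − a σc/δc`. -/
theorem stmt4 (σc δc a ρ : ℝ) (hσ : 0 < σc) (hδ : 0 < δc) (ha : 0 < a)
    (hρ : a * σc / δc < ρ) (p c : ℝ) :
    StrongConvexOn (Set.Ici (0 : ℝ)) (ρ - a * σc / δc)
      (fun t => a * phic σc δc t - p * t + (ρ / 2) * (t - c) ^ 2) := by
  rw [strongConvexOn_iff_convex]
  have key : ∀ t : ℝ, a * phic σc δc t - p * t + (ρ / 2) * (t - c) ^ 2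
      - (ρ - a * σc / δc) / (2 : ℝ) * ‖t‖ ^ 2
      = (a * σc / (2 * δc)) * (max (t - δc) 0) ^ 2 + ((a * σc - p - ρ * c) * t + ρ / 2 * c ^ 2) := by
    intro t
    rw [Real.norm_eq_abs, sq_abs]
    unfold phic
    split_ifs with h
    · rw [max_eq_right (by linarith)]
      field_simp
      ring
    · rw [max_eq_left (by linarith)]
      field_simp
      ring
  simp only [key]
  have hK : 0 ≤ a * σc / (2 * δc) := by positivity
  refine ConvexOn.add ((aux_convex δc).smul hK) ⟨convex_Ici 0, fun x _ y _ u v _ _ huv => ?_⟩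
  simp only [smul_eq_mul]
  have : v = 1 - u := by linarith
  subst this
  apply le_of_eq
  ring
end

section
/- Let σ_c > 0, δ_c > 0, a > 0, ρ > a σ_c/δ_c, and p ∈ ℝ. Define g(t) = a φ_c(t) − p t + (ρ/2) t². Then t = 0 is a global minimizer of g over [0, ∞) if and only if p ≤ a σ_c; moreover, when p ≤ a σ_c, t = 0 is the unique global minimizer of g over [0, ∞). -/
/-- pre-activation criterion. `t = 0` globally minimizes the scalar
subproblem over `[0, ∞)` iff `p ≤ a σc`, and in that case it is the unique minimizer. -/
theorem stmt5 (σc δc a ρ : ℝ) (hσ : 0 < σc) (hδ : 0 < δc) (ha : 0 < a)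
    (hρ : a * σc / δc < ρ) (p : ℝ) :
    let g : ℝ → ℝ := fun t => a * phic σc δc t - p * t + (ρ / 2) * t ^ 2
    ((∀ t ∈ Set.Ici (0 : ℝ), g 0 ≤ g t) ↔ p ≤ a * σc) ∧
      (p ≤ a * σc → ∀ t ∈ Set.Ici (0 : ℝ), t ≠ 0 → g 0 < g t) := by
  intro g
  obtain ⟨k, hk⟩ : ∃ k, k = σc / δc := ⟨_, rfl⟩
  have hσk : σc = k * δc := by rw [hk]; field_simp
  have hkpos : 0 < k := by rw [hk]; positivity
  have hρ' : 0 < ρ - a * k := by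
    rw [hk, ← mul_div_assoc]; linarith
  have hq : ∀ t, σc * t - σc * t ^ 2 / (2 * δc) = σc * t - k * t ^ 2 / 2 := by
    intro t; rw [hk]; field_simp
  have h0 : g 0 = 0 := by simp [g, phic, hδ.le]
  have hlow : ∀ t, σc * t - k * t ^ 2 / 2 ≤ phic σc δc t := by
    intro t
    unfold phic
    split_ifs with h
    · rw [hq]
    · rw [hσk]
      nlinarith [mul_nonneg hkpos.le (sq_nonneg (t - δc))]
  have huniq : p ≤ a * σc → ∀ t ∈ Set.Ici (0 : ℝ), t ≠ 0 → g 0 < g t := by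
    intro hp t ht htne
    have htpos : 0 < t := lt_of_le_of_ne ht (Ne.symm htne)
    rw [h0]
    have h1 := mul_le_mul_of_nonneg_left (hlow t) ha.le
    have h2 : 0 ≤ (a * σc - p) * t := mul_nonneg (by linarith) htpos.le
    have h3 : 0 < (ρ - a * k) * t ^ 2 := by positivity
    show 0 < a * phic σc δc t - p * t + (ρ / 2) * t ^ 2
    linarith
  refine ⟨⟨fun h => ?_, fun hp t ht => ?_⟩, huniq⟩
  · by_contra! hp
    obtain ⟨t, htdef⟩ : ∃ t, t = min δc ((p - a * σc) / (ρ - a * k)) := ⟨_, rfl⟩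
    have htpos : 0 < t := by
      rw [htdef]; exact lt_min hδ (div_pos (by linarith) hρ')
    have htd : t ≤ δc := htdef ▸ min_le_left _ _
    have htr : t * (ρ - a * k) ≤ p - a * σc := by
      rw [← le_div_iff₀ hρ', htdef]; exact min_le_right _ _
    have h1 := h t htpos.le
    have h2 : g t = a * (σc * t - k * t ^ 2 / 2) - p * t + (ρ / 2) * t ^ 2 := by
      simp only [g, phic, if_pos htd, hq]
    rw [h0, h2] at h1
    have h3 := mul_le_mul_of_nonneg_left htr htpos.le
    have h4 : 0 < (p - a * σc) * t := mul_pos (by linarith) htpos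
    linarith
  · rcases eq_or_ne t 0 with rfl | hne
    · exact le_rfl
    · exact (huniq hp t ht hne).le
end

section
/- Let σ_c > 0, δ_c > 0, a > 0, ρ > a σ_c/δ_c, and p ∈ ℝ with a σ_c < p ≤ ρ δ_c. Define g(t) = a φ_c(t) − p t + (ρ/2) t². Then t* = (p − a σ_c)/(ρ − a σ_c/δ_c) satisfies 0 < t* ≤ δ_c, and t* is the unique global minimizer of g over [0, ∞). -/
/-- softening regime. If `a σc < p ≤ ρ δc` then
`t* = (p − a σc)/(ρ − a σc/δc)` satisfies `0 < t* ≤ δc` and is the unique global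
minimizer of the scalar subproblem over `[0, ∞)`. -/
theorem stmt6 (σc δc a ρ : ℝ) (hσ : 0 < σc) (hδ : 0 < δc) (ha : 0 < a)
    (hρ : a * σc / δc < ρ) (p : ℝ) (hp₁ : a * σc < p) (hp₂ : p ≤ ρ * δc) :
    let g : ℝ → ℝ := fun t => a * phic σc δc t - p * t + (ρ / 2) * t ^ 2
    let tstar : ℝ := (p - a * σc) / (ρ - a * σc / δc)
    0 < tstar ∧ tstar ≤ δc ∧ ∀ t ∈ Set.Ici (0 : ℝ), t ≠ tstar → g tstar < g t := by
  intro g tstar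
  obtain ⟨k, hk⟩ : ∃ k, k = σc / δc := ⟨_, rfl⟩
  have hkpos : 0 < k := hk ▸ div_pos hσ hδ
  have hσk : σc = k * δc := by rw [hk]; field_simp
  have hak : a * σc / δc = a * k := by rw [hk]; ring
  have hm : 0 < ρ - a * k := by rw [hak] at hρ; linarith
  have hts : tstar = (p - a * σc) / (ρ - a * k) := by simp only [tstar, hak]
  have hmul : tstar * (ρ - a * k) = p - a * k * δc := by
    rw [hts, div_mul_cancel₀ _ hm.ne', hσk]; ring
  have hpos : 0 < tstar := by rw [hts]; exact div_pos (by linarith) hm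
  have hle : tstar ≤ δc := by
    rw [hts, div_le_iff₀ hm, hσk]; nlinarith
  -- the value of the potential on either branch
  have hphi1 : ∀ t, t ≤ δc → phic σc δc t = k * (δc * t - t ^ 2 / 2) := by
    intro t ht
    rw [phic, if_pos ht, hσk]; field_simp
  have hphi2 : ∀ t, k * (δc * t - t ^ 2 / 2) ≤ phic σc δc t := by
    intro t
    by_cases ht : t ≤ δc
    · exact (hphi1 t ht).ge
    · rw [phic, if_neg ht, hσk]
      nlinarith [mul_nonneg hkpos.le (sq_nonneg (t - δc))]
  refine ⟨hpos, hle, fun t _ hne => ?_⟩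
  clear_value tstar
  have h1 := mul_le_mul_of_nonneg_left (hphi2 t) ha.le
  have h2 : 0 < (ρ - a * k) * (t - tstar) ^ 2 :=
    mul_pos hm (by have := sub_ne_zero.mpr hne; positivity)
  have hp : p = tstar * (ρ - a * k) + a * k * δc := by linarith
  simp only [g]
  rw [hphi1 tstar hle]
  subst hp
  nlinarith
end

section
/- Let σ_c > 0, δ_c > 0, a > 0, ρ > a σ_c/δ_c, and p ∈ ℝ with p ≥ ρ δ_c. Define g(t) = a φ_c(t) − p t + (ρ/2) t². Then t* = p/ρ satisfies t* ≥ δ_c, and t* is the unique global minimizer of g over [0, ∞). -/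
/-- fully open regime. If `p ≥ ρ δc` then `t* = p/ρ` satisfies
`t* ≥ δc` and is the unique global minimizer of the scalar subproblem over `[0, ∞)`. -/
theorem stmt7 (σc δc a ρ : ℝ) (hσ : 0 < σc) (hδ : 0 < δc) (ha : 0 < a)
    (hρ : a * σc / δc < ρ) (p : ℝ) (hp : ρ * δc ≤ p) :
    let g : ℝ → ℝ := fun t => a * phic σc δc t - p * t + (ρ / 2) * t ^ 2
    let tstar : ℝ := p / ρ
    δc ≤ tstar ∧ ∀ t ∈ Set.Ici (0 : ℝ), t ≠ tstar → g tstar < g t := by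
  intro g tstar
  have hk : 0 < a * σc / δc := by positivity
  have hρ0 : 0 < ρ := hk.trans hρ
  have hs : δc ≤ tstar := by
    show δc ≤ p / ρ
    rw [le_div_iff₀ hρ0]
    linarith
  have hps : p = ρ * tstar := by
    show p = ρ * (p / ρ)
    field_simp
  have hφ : ∀ t, t ≤ δc →
      a * phic σc δc t = a * (σc * δc / 2) - (a * σc / δc) / 2 * (δc - t) ^ 2 := by
    intro t ht
    simp only [phic, if_pos ht]
    field_simp
    ring
  have hφ' : ∀ t, δc ≤ t → a * phic σc δc t = a * (σc * δc / 2) := by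
    intro t ht
    rcases ht.eq_or_lt with h | h
    · rw [hφ t h.ge, ← h]
      ring
    · simp only [phic, if_neg (not_le.mpr h)]
  refine ⟨hs, fun t _ hne => ?_⟩
  have hgs : g tstar = a * phic σc δc tstar - p * tstar + (ρ / 2) * tstar ^ 2 := rfl
  have hgt : g t = a * phic σc δc t - p * t + (ρ / 2) * t ^ 2 := rfl
  have hsq : 0 < (t - tstar) ^ 2 := by
    have := sub_ne_zero.mpr hne
    positivity
  have h1 := mul_lt_mul_of_pos_right hρ hsq
  have h2 := mul_pos hρ0 hsq
  rw [hgs, hgt, hφ' tstar hs, hps]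
  rcases le_total t δc with h | h
  · rw [hφ t h]
    have h3 : (δc - t) ^ 2 ≤ (t - tstar) ^ 2 := by nlinarith
    have h4 := mul_le_mul_of_nonneg_left h3 hk.le
    linarith
  · rw [hφ' t h]
    linarith
end

section
/- Let σ_c > 0, δ_c > 0, a > 0, and ρ ≥ a σ_c/δ_c. Then the function h(t) = a φ_c(t) + (ρ/2) t² is convex and monotone nondecreasing on [0, ∞). -/
/-- for `ρ ≥ a σc/δc`, the cohesive-plus-penalty radial profile
`h(t) = a φc(t) + (ρ/2) t²` is convex and nondecreasing on `[0, ∞)`. -/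
theorem stmt14 (σc δc a ρ : ℝ) (hσ : 0 < σc) (hδ : 0 < δc) (ha : 0 < a)
    (hρ : a * σc / δc ≤ ρ) :
    ConvexOn ℝ (Set.Ici (0 : ℝ)) (fun t => a * phic σc δc t + (ρ / 2) * t ^ 2) ∧
      MonotoneOn (fun t => a * phic σc δc t + (ρ / 2) * t ^ 2) (Set.Ici (0 : ℝ)) := by
  have hk : 0 ≤ a * σc / δc := by positivity
  have heq : (fun t => a * phic σc δc t + (ρ / 2) * t ^ 2) =
      fun t => a * σc * t + ((ρ - a * σc / δc) / 2 * t ^ 2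
        + a * σc / δc / 2 * (max (t - δc) 0) ^ 2) := by
    funext t
    unfold phic
    split_ifs with h
    · rw [max_eq_right (by linarith)]
      field_simp
      ring
    · rw [max_eq_left (by linarith)]
      field_simp
      ring
  rw [heq]
  have hc : 0 ≤ (ρ - a * σc / δc) / 2 := by linarith
  have hk2 : 0 ≤ a * σc / δc / 2 := by linarith
  have has : 0 ≤ a * σc := by positivity
  constructor
  · have hconv : Convex ℝ (Set.Ici (0 : ℝ)) := convex_Ici 0
    have hid : ConvexOn ℝ (Set.Ici (0 : ℝ)) (fun t : ℝ => t) := convexOn_id hconv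
    have h1 : ConvexOn ℝ (Set.Ici (0 : ℝ)) (fun t : ℝ => a * σc * t) := hid.smul has
    have h2 : ConvexOn ℝ (Set.Ici (0 : ℝ)) (fun t : ℝ => (ρ - a * σc / δc) / 2 * t ^ 2) :=
      (hid.pow (fun _ hx => hx) 2).smul hc
    have h3 : ConvexOn ℝ (Set.Ici (0 : ℝ)) (fun t : ℝ => max (t - δc) 0) :=
      (hid.sub (concaveOn_const δc hconv)).sup (convexOn_const 0 hconv)
    have h4 : ConvexOn ℝ (Set.Ici (0 : ℝ))
        (fun t : ℝ => a * σc / δc / 2 * (max (t - δc) 0) ^ 2) :=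
      (h3.pow (fun _ _ => le_max_right _ _) 2).smul hk2
    exact h1.add (h2.add h4)
  · intro x hx y hy hxy
    have hx0 : 0 ≤ x := hx
    have hm : 0 ≤ max (x - δc) 0 := le_max_right _ _
    dsimp only
    gcongr
end

section
/- Let σ_c > 0, δ_c > 0, a > 0, and ρ > a σ_c/δ_c. Then for any p, c ∈ ℝ² (Euclidean plane), the function G(δ) = a φ_c(‖δ‖) − ⟨p, δ⟩ + (ρ/2) ‖δ − c‖² is convex on ℝ². -/
/-- The Euclidean norm in coordinates is convex. -/
theorem sqrt_convex_aux :
    ConvexOn ℝ (Set.univ : Set (ℝ × ℝ)) (fun δ : ℝ × ℝ => Real.sqrt (δ.1 ^ 2 + δ.2 ^ 2)) := by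
  have h := (convexOn_univ_norm (E := ℂ)).comp_linearMap
    (Complex.equivRealProdCLM.symm.toLinearEquiv.toLinearMap)
  have e : (fun δ : ℝ × ℝ => Real.sqrt (δ.1 ^ 2 + δ.2 ^ 2)) =
      norm ∘ (Complex.equivRealProdCLM.symm.toLinearEquiv.toLinearMap) := by
    funext δ
    simp [Complex.norm_eq_sqrt_sq_add_sq]
  rw [e]
  simpa using h

theorem phic_aux (σc δc t : ℝ) (hδ : 0 < δc) :
    phic σc δc t = σc * t + σc / δc / 2 * (max (t - δc) 0) ^ 2 - σc / δc / 2 * t ^ 2 := by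
  unfold phic
  split_ifs with h
  · rw [max_eq_right (by linarith)]
    field_simp
    ring
  · rw [max_eq_left (by linarith)]
    field_simp
    ring

/-- the two-dimensional crack-opening subproblem
`G(δ) = a φc(‖δ‖) − ⟨p, δ⟩ + (ρ/2) ‖δ − c‖²` (Euclidean norm on the plane,
written in coordinates) is convex on ℝ² whenever `ρ > a σc/δc`. -/
theorem stmt15 (σc δc a ρ : ℝ) (hσ : 0 < σc) (hδ : 0 < δc) (ha : 0 < a)
    (hρ : a * σc / δc < ρ) (p c : ℝ × ℝ) :
    ConvexOn ℝ (Set.univ : Set (ℝ × ℝ)) (fun δ : ℝ × ℝ =>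
      a * phic σc δc (Real.sqrt (δ.1 ^ 2 + δ.2 ^ 2))
        - (p.1 * δ.1 + p.2 * δ.2)
        + (ρ / 2) * ((δ.1 - c.1) ^ 2 + (δ.2 - c.2) ^ 2)) := by
  have hn := sqrt_convex_aux
  have hm : ConvexOn ℝ (Set.univ : Set (ℝ × ℝ))
      (fun δ : ℝ × ℝ => (max (Real.sqrt (δ.1 ^ 2 + δ.2 ^ 2) - δc) 0) ^ 2) := by
    have h1 := (hn.add_const (-δc)).sup (convexOn_const (0 : ℝ) convex_univ)
    exact h1.pow (fun x _ => le_max_right _ _) 2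
  have hk : 0 < ρ - a * (σc / δc) := by
    rw [← mul_div_assoc]; linarith
  have hk' : 0 < σc / δc := by positivity
  generalize hkd : σc / δc = k at hk hk'
  refine ⟨convex_univ, ?_⟩
  intro x _ y _ s t hs ht hst
  have h1 := hn.2 (Set.mem_univ x) (Set.mem_univ y) hs ht hst
  have h2 := hm.2 (Set.mem_univ x) (Set.mem_univ y) hs ht hst
  simp only [phic_aux σc δc _ hδ, hkd]
  have sqx : ∀ z : ℝ × ℝ, Real.sqrt (z.1 ^ 2 + z.2 ^ 2) ^ 2 = z.1 ^ 2 + z.2 ^ 2 :=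
    fun z => Real.sq_sqrt (by positivity)
  simp only [sqx]
  simp only [smul_eq_mul] at h1 h2 ⊢
  generalize Real.sqrt ((s • x + t • y).1 ^ 2 + (s • x + t • y).2 ^ 2) = N at *
  generalize Real.sqrt (x.1 ^ 2 + x.2 ^ 2) = X at *
  generalize Real.sqrt (y.1 ^ 2 + y.2 ^ 2) = Y at *
  generalize max (N - δc) 0 ^ 2 = N' at *
  generalize max (X - δc) 0 ^ 2 = X' at *
  generalize max (Y - δc) 0 ^ 2 = Y' at *
  simp only [Prod.fst_add, Prod.snd_add, Prod.smul_fst, Prod.smul_snd, smul_eq_mul]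
  have g1 := mul_le_mul_of_nonneg_left h1 (mul_pos ha hσ).le
  have g2 := mul_le_mul_of_nonneg_left h2 (mul_pos ha hk').le
  have g3 : 0 ≤ (ρ - a * k) * (s * t * ((x.1 - y.1) ^ 2 + (x.2 - y.2) ^ 2)) := by positivity
  obtain rfl : t = 1 - s := by linarith
  linear_combination g1 + g2 / 2 + g3 / 2
end

section
/- Let σ_c > 0, δ_c > 0, a > 0, ρ > a σ_c/δ_c, and p = (p_n, p_s) ∈ ℝ². Define G(δ) = a φ_c(‖δ‖) − ⟨p, δ⟩ + (ρ/2) ‖δ‖² on ℝ², and let p_eff = √( max(p_n, 0)² + p_s² ). Then δ = 0 is a global minimizer of G over the half-plane { δ = (δ_n, δ_s) : δ_n ≥ 0 } if and only if p_eff ≤ a σ_c. -/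
theorem phic_lower (σc δc t : ℝ) (hσ : 0 < σc) (hδ : 0 < δc) :
    σc * t - σc / δc * t ^ 2 / 2 ≤ phic σc δc t := by
  unfold phic
  split_ifs with h
  · apply le_of_eq; field_simp
  · have h1 : σc * δc / 2 - (σc * t - σc / δc * t ^ 2 / 2) = σc * (t - δc) ^ 2 / (2 * δc) := by
      field_simp; ring
    have h2 : 0 ≤ σc * (t - δc) ^ 2 / (2 * δc) := by positivity
    linarith

theorem phic_upper (σc δc t : ℝ) (hσ : 0 < σc) (hδ : 0 < δc) (ht : 0 ≤ t) :
    phic σc δc t ≤ σc * t := by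
  unfold phic
  split_ifs with h
  · have h2 : 0 ≤ σc * t ^ 2 / (2 * δc) := by positivity
    linarith
  · have h2 : 0 ≤ σc * (t - δc) := mul_nonneg hσ.le (by linarith)
    have h3 : 0 < σc * δc := by positivity
    nlinarith

/-- activation criterion. `δ = 0` globally minimizes the crack-opening
subproblem over the half-plane `δ_n ≥ 0` iff the effective traction magnitude
`p_eff = √(max(p_n,0)² + p_s²)` satisfies `p_eff ≤ a σc`. -/
theorem stmt16 (σc δc a ρ : ℝ) (hσ : 0 < σc) (hδ : 0 < δc) (ha : 0 < a)
    (hρ : a * σc / δc < ρ) (p : ℝ × ℝ) :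
    let G : ℝ × ℝ → ℝ := fun δ =>
      a * phic σc δc (Real.sqrt (δ.1 ^ 2 + δ.2 ^ 2))
        - (p.1 * δ.1 + p.2 * δ.2) + (ρ / 2) * (δ.1 ^ 2 + δ.2 ^ 2)
    let peff : ℝ := Real.sqrt ((max p.1 0) ^ 2 + p.2 ^ 2)
    (∀ δ : ℝ × ℝ, 0 ≤ δ.1 → G 0 ≤ G δ) ↔ peff ≤ a * σc := by
  intro G peff
  have hρ0 : 0 < ρ := lt_trans (by positivity) hρ
  have hG0 : G 0 = 0 := by
    simp [G, phic, hδ.le]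
  have hP0 : 0 ≤ peff := Real.sqrt_nonneg _
  have hPsq : peff ^ 2 = (max p.1 0) ^ 2 + p.2 ^ 2 := Real.sq_sqrt (by positivity)
  rw [hG0]
  constructor
  · intro H
    by_contra hlt
    push Not at hlt
    have hP : 0 < peff := lt_trans (by positivity) hlt
    set s : ℝ := (peff - a * σc) / (ρ * peff) with hs
    have hs0 : 0 < s := div_pos (by linarith) (by positivity)
    have hsP : ρ * (s * peff) = peff - a * σc := by
      rw [hs]; field_simp
    have h1 := H (s * max p.1 0, s * p.2) (mul_nonneg hs0.le (le_max_right _ _))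
    have hn : (s * max p.1 0) ^ 2 + (s * p.2) ^ 2 = (s * peff) ^ 2 := by
      rw [mul_pow s peff, hPsq]; ring
    have hm : p.1 * max p.1 0 = (max p.1 0) ^ 2 := by
      rcases le_total p.1 0 with h | h
      · simp [max_eq_right h]
      · rw [max_eq_left h]; ring
    have hin : p.1 * (s * max p.1 0) + p.2 * (s * p.2) = s * peff ^ 2 := by
      rw [hPsq, ← hm]; ring
    simp only [G] at h1
    rw [hn, hin, Real.sqrt_sq (by positivity)] at h1
    have h2 := mul_le_mul_of_nonneg_left
      (phic_upper σc δc (s * peff) hσ hδ (by positivity)) ha.le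
    have h3 : ρ / 2 * (s * peff) ^ 2 = (peff - a * σc) * (s * peff) / 2 := by
      rw [← hsP]; ring
    have h4 : 0 < (peff - a * σc) * (s * peff) := mul_pos (by linarith) (by positivity)
    nlinarith
  · intro hle δ hδ1
    simp only [G]
    set t := Real.sqrt (δ.1 ^ 2 + δ.2 ^ 2) with ht
    have ht0 : 0 ≤ t := Real.sqrt_nonneg _
    have htsq : t ^ 2 = δ.1 ^ 2 + δ.2 ^ 2 := Real.sq_sqrt (by positivity)
    rw [← htsq]
    have h1 := mul_le_mul_of_nonneg_left (phic_lower σc δc t hσ hδ) ha.le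
    have h2 : p.1 * δ.1 ≤ max p.1 0 * δ.1 :=
      mul_le_mul_of_nonneg_right (le_max_left _ _) hδ1
    have h3 : max p.1 0 * δ.1 + p.2 * δ.2 ≤ peff * t := by
      refine abs_le_of_sq_le_sq' ?_ (by positivity) |>.2
      rw [mul_pow, hPsq, htsq]
      nlinarith [sq_nonneg (max p.1 0 * δ.2 - p.2 * δ.1)]
    have h4 : peff * t ≤ a * σc * t := mul_le_mul_of_nonneg_right hle ht0
    have h5 : a * σc / δc * t ^ 2 ≤ ρ * t ^ 2 :=
      mul_le_mul_of_nonneg_right hρ.le (sq_nonneg t)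
    have h6 : a * (σc * t - σc / δc * t ^ 2 / 2)
        = a * σc * t - a * σc / δc * t ^ 2 / 2 := by ring
    linarith
end

section
/- Let σ_c > 0, δ_c > 0, a > 0, ρ > 0, and p = (p_n, p_s) ∈ ℝ² with p_n ≤ 0. Define G(δ) = a φ_c(‖δ‖) − ⟨p, δ⟩ + (ρ/2) ‖δ‖² on ℝ². Then for every δ = (δ_n, δ_s) with δ_n ≥ 0, G(δ_n, δ_s) ≥ G(0, δ_s), with strict inequality whenever δ_n > 0. Consequently every global minimizer of G over the half-plane { δ : δ_n ≥ 0 } has zero normal opening δ_n = 0. -/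
theorem phic_eq_aux (σc δc t : ℝ) (hδ : 0 < δc) :
    phic σc δc t = σc * δc / 2 - σc / (2 * δc) * (max (δc - t) 0) ^ 2 := by
  unfold phic
  split_ifs with h
  · rw [max_eq_left (by linarith)]
    field_simp
    ring
  · rw [max_eq_right (by linarith)]
    ring

theorem phic_mono_aux (σc δc s t : ℝ) (hσ : 0 < σc) (hδ : 0 < δc) (h : s ≤ t) :
    phic σc δc s ≤ phic σc δc t := by
  rw [phic_eq_aux _ _ _ hδ, phic_eq_aux _ _ _ hδ]
  gcongr

/-- contact branch. If the normal effective traction is compressive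
(`p_n ≤ 0`), then `G(δ_n, δ_s) ≥ G(0, δ_s)` for every `δ_n ≥ 0`, strictly when
`δ_n > 0`; hence every global minimizer over the half-plane has `δ_n = 0`. -/
theorem stmt17 (σc δc a ρ : ℝ) (hσ : 0 < σc) (hδ : 0 < δc) (ha : 0 < a)
    (hρ : 0 < ρ) (p : ℝ × ℝ) (hpn : p.1 ≤ 0) :
    let G : ℝ × ℝ → ℝ := fun δ =>
      a * phic σc δc (Real.sqrt (δ.1 ^ 2 + δ.2 ^ 2))
        - (p.1 * δ.1 + p.2 * δ.2) + (ρ / 2) * (δ.1 ^ 2 + δ.2 ^ 2)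
    (∀ δn δs : ℝ, 0 ≤ δn → G (0, δs) ≤ G (δn, δs)) ∧
      (∀ δn δs : ℝ, 0 < δn → G (0, δs) < G (δn, δs)) ∧
      ∀ δ : ℝ × ℝ, 0 ≤ δ.1 → (∀ δ' : ℝ × ℝ, 0 ≤ δ'.1 → G δ ≤ G δ') → δ.1 = 0 := by
  intro G
  have key : ∀ δn δs : ℝ, 0 ≤ δn → G (0, δs) + ρ / 2 * δn ^ 2 ≤ G (δn, δs) := by
    intro δn δs hn
    have h1 : phic σc δc (Real.sqrt ((0 : ℝ) ^ 2 + δs ^ 2))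
        ≤ phic σc δc (Real.sqrt (δn ^ 2 + δs ^ 2)) := by
      apply phic_mono_aux _ _ _ _ hσ hδ
      apply Real.sqrt_le_sqrt
      nlinarith [sq_nonneg δn]
    have h2 := mul_le_mul_of_nonneg_left h1 ha.le
    have h3 : p.1 * δn ≤ 0 := mul_nonpos_of_nonpos_of_nonneg hpn hn
    simp only [G]
    generalize phic σc δc (Real.sqrt ((0 : ℝ) ^ 2 + δs ^ 2)) = A at *
    generalize phic σc δc (Real.sqrt (δn ^ 2 + δs ^ 2)) = B at *
    clear_value G
    nlinarith
  have strict : ∀ δn δs : ℝ, 0 < δn → G (0, δs) < G (δn, δs) := by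
    intro δn δs hn
    have h1 := key δn δs hn.le
    have h2 : 0 < ρ / 2 * δn ^ 2 := by positivity
    linarith
  refine ⟨?_, strict, ?_⟩
  · intro δn δs hn
    have h1 := key δn δs hn
    have h2 : 0 ≤ ρ / 2 * δn ^ 2 := by positivity
    linarith
  · intro δ h0 hmin
    by_contra hne
    have hpos : 0 < δ.1 := lt_of_le_of_ne h0 (Ne.symm hne)
    exact absurd (hmin (0, δ.2) le_rfl) (not_le.mpr (strict δ.1 δ.2 hpos))
end

section
/- Let σ_c > 0, δ_c > 0, a > 0, ρ > a σ_c/δ_c, and p = (p_n, p_s) ∈ ℝ² with p_n ≥ 0 and a σ_c < ‖p‖ ≤ ρ δ_c. Define G(δ) = a φ_c(‖δ‖) − ⟨p, δ⟩ + (ρ/2) ‖δ‖² on ℝ². Then the unique global minimizer of G over the half-plane { δ = (δ_n, δ_s) : δ_n ≥ 0 } is δ* = t* · p/‖p‖, where t* = (‖p‖ − a σ_c)/(ρ − a σ_c/δ_c). -/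
/-- softening regime of the 2D subproblem. For `p_n ≥ 0` and
`a σc < ‖p‖ ≤ ρ δc`, the unique global minimizer of `G` over the half-plane
`δ_n ≥ 0` is `δ* = t* p/‖p‖` with `t* = (‖p‖ − a σc)/(ρ − a σc/δc)`. -/
theorem stmt18 (σc δc a ρ : ℝ) (hσ : 0 < σc) (hδ : 0 < δc) (ha : 0 < a)
    (hρ : a * σc / δc < ρ) (p : ℝ × ℝ) (hpn : 0 ≤ p.1)
    (hp₁ : a * σc < Real.sqrt (p.1 ^ 2 + p.2 ^ 2))
    (hp₂ : Real.sqrt (p.1 ^ 2 + p.2 ^ 2) ≤ ρ * δc) :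
    let G : ℝ × ℝ → ℝ := fun δ =>
      a * phic σc δc (Real.sqrt (δ.1 ^ 2 + δ.2 ^ 2))
        - (p.1 * δ.1 + p.2 * δ.2) + (ρ / 2) * (δ.1 ^ 2 + δ.2 ^ 2)
    let np : ℝ := Real.sqrt (p.1 ^ 2 + p.2 ^ 2)
    let tstar : ℝ := (np - a * σc) / (ρ - a * σc / δc)
    let δstar : ℝ × ℝ := ((tstar / np) * p.1, (tstar / np) * p.2)
    0 ≤ δstar.1 ∧ ∀ δ : ℝ × ℝ, 0 ≤ δ.1 → δ ≠ δstar → G δstar < G δ := by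
  intro G np tstar δstar
  have hc : 0 < a * σc := mul_pos ha hσ
  have hN : 0 < np := lt_trans hc hp₁
  have hNsq : np ^ 2 = p.1 ^ 2 + p.2 ^ 2 := Real.sq_sqrt (by positivity)
  have hm : 0 < ρ - a * σc / δc := sub_pos.mpr hρ
  have hp1' : 0 < np - a * σc := sub_pos.mpr hp₁
  have ht : 0 < tstar := div_pos hp1' hm
  have hmt : (ρ - a * σc / δc) * tstar = np - a * σc := mul_div_cancel₀ _ hm.ne'
  have hk : a * σc / δc * δc = a * σc := div_mul_cancel₀ _ hδ.ne'
  have htd : tstar ≤ δc := by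
    refine (div_le_iff₀ hm).mpr ?_
    have : np ≤ ρ * δc := hp₂
    nlinarith
  obtain ⟨s, hs⟩ : ∃ s, s = tstar / np := ⟨_, rfl⟩
  have hs0 : 0 < s := hs ▸ div_pos ht hN
  have hsN : s * np = tstar := hs ▸ div_mul_cancel₀ _ hN.ne'
  have e1 : δstar.1 = s * p.1 := by rw [hs]
  have e2 : δstar.2 = s * p.2 := by rw [hs]
  refine ⟨by rw [e1]; positivity, ?_⟩
  intro δ _ hne
  have hsq : δstar.1 ^ 2 + δstar.2 ^ 2 = tstar ^ 2 := by
    rw [e1, e2, ← hsN, mul_pow s np, hNsq]; ring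
  have hip : p.1 * δstar.1 + p.2 * δstar.2 = np * tstar := by
    rw [e1, e2, ← hsN]; linear_combination (-s) * hNsq
  have hquad : ∀ t : ℝ, a * (σc * t - σc * t ^ 2 / (2 * δc))
      = a * σc * t - a * σc / δc * t ^ 2 / 2 := by
    intro t; field_simp
  have hGs : G δstar = a * σc * tstar - a * σc / δc * tstar ^ 2 / 2
      - np * tstar + ρ / 2 * tstar ^ 2 := by
    change a * phic σc δc (Real.sqrt (δstar.1 ^ 2 + δstar.2 ^ 2))
        - (p.1 * δstar.1 + p.2 * δstar.2) + (ρ / 2) * (δstar.1 ^ 2 + δstar.2 ^ 2) = _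
    rw [hsq, hip, Real.sqrt_sq ht.le, phic, if_pos htd, hquad]
  obtain ⟨r, hr⟩ : ∃ r, r = Real.sqrt (δ.1 ^ 2 + δ.2 ^ 2) := ⟨_, rfl⟩
  have hr0 : 0 ≤ r := hr ▸ Real.sqrt_nonneg _
  have hrsq : r ^ 2 = δ.1 ^ 2 + δ.2 ^ 2 := hr ▸ Real.sq_sqrt (by positivity)
  have hphi : a * σc * r - a * σc / δc * r ^ 2 / 2 ≤ a * phic σc δc r := by
    rw [← hquad]
    refine mul_le_mul_of_nonneg_left ?_ ha.le
    unfold phic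
    split_ifs
    · exact le_rfl
    · have h : σc * δc / 2 - (σc * r - σc * r ^ 2 / (2 * δc))
          = σc / (2 * δc) * (r - δc) ^ 2 := by
        field_simp; ring
      have : 0 ≤ σc / (2 * δc) * (r - δc) ^ 2 := by positivity
      linarith
  have hG : G δ = a * phic σc δc r - (p.1 * δ.1 + p.2 * δ.2) + ρ / 2 * r ^ 2 := by
    change a * phic σc δc (Real.sqrt (δ.1 ^ 2 + δ.2 ^ 2))
        - (p.1 * δ.1 + p.2 * δ.2) + (ρ / 2) * (δ.1 ^ 2 + δ.2 ^ 2) = _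
    rw [← hr, hrsq]
  have hcs : p.1 * δ.1 + p.2 * δ.2 ≤ np * r := by
    refine abs_le_of_sq_le_sq' ?_ (by positivity) |>.2
    rw [mul_pow, hNsq, hrsq]
    nlinarith [sq_nonneg (p.1 * δ.2 - p.2 * δ.1)]
  have hdist : (δ.1 - δstar.1) ^ 2 + (δ.2 - δstar.2) ^ 2
      = (r - tstar) ^ 2 + 2 * s * (np * r - (p.1 * δ.1 + p.2 * δ.2)) := by
    have : (δ.1 - δstar.1) ^ 2 + (δ.2 - δstar.2) ^ 2 = (δ.1 ^ 2 + δ.2 ^ 2)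
      + (δstar.1 ^ 2 + δstar.2 ^ 2) - 2 * (δ.1 * δstar.1 + δ.2 * δstar.2) := by ring
    rw [this, hsq, ← hrsq, e1, e2]
    linear_combination (-2 * r) * hsN
  have hkey : 0 < (np * r - (p.1 * δ.1 + p.2 * δ.2))
      + (ρ - a * σc / δc) / 2 * (r - tstar) ^ 2 := by
    have h2 : 0 ≤ (ρ - a * σc / δc) / 2 * (r - tstar) ^ 2 := by positivity
    rcases hcs.lt_or_eq with h | h
    · linarith
    · have hrt : r - tstar ≠ 0 := by
        intro h0
        rw [h, h0] at hdist
        have hd0 : (δ.1 - δstar.1) ^ 2 + (δ.2 - δstar.2) ^ 2 = 0 := by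
          rw [hdist]; ring
        apply hne
        have h3 : (δ.1 - δstar.1) = 0 := by
          apply pow_eq_zero_iff (two_ne_zero) |>.mp
          linarith only [hd0, sq_nonneg (δ.1 - δstar.1), sq_nonneg (δ.2 - δstar.2)]
        have h4 : (δ.2 - δstar.2) = 0 := by
          apply pow_eq_zero_iff (two_ne_zero) |>.mp
          linarith only [hd0, sq_nonneg (δ.1 - δstar.1), sq_nonneg (δ.2 - δstar.2)]
        exact Prod.ext (sub_eq_zero.mp h3) (sub_eq_zero.mp h4)
      have : 0 < (ρ - a * σc / δc) / 2 * (r - tstar) ^ 2 := by positivity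
      linarith
  have hfin : (a * σc * r - a * σc / δc * r ^ 2 / 2 - (p.1 * δ.1 + p.2 * δ.2) + ρ / 2 * r ^ 2)
      - G δstar = (np * r - (p.1 * δ.1 + p.2 * δ.2))
      + (ρ - a * σc / δc) / 2 * (r - tstar) ^ 2 := by
    rw [hGs]
    linear_combination (r - tstar) * hmt
  rw [hG]
  linarith
end

section
/- Let σ_c > 0, δ_c > 0, a > 0, ρ > a σ_c/δ_c, and p = (p_n, p_s) ∈ ℝ² with p_n ≥ 0 and ‖p‖ ≥ ρ δ_c. Define G(δ) = a φ_c(‖δ‖) − ⟨p, δ⟩ + (ρ/2) ‖δ‖² on ℝ². Then the unique global minimizer of G over the half-plane { δ = (δ_n, δ_s) : δ_n ≥ 0 } is δ* = p/ρ, whose norm satisfies ‖δ*‖ ≥ δ_c. -/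
/-- fully open regime of the 2D subproblem. For `p_n ≥ 0` and
`‖p‖ ≥ ρ δc`, the unique global minimizer of `G` over the half-plane `δ_n ≥ 0`
is `δ* = p/ρ`, whose norm is at least `δc`. -/
theorem stmt19 (σc δc a ρ : ℝ) (hσ : 0 < σc) (hδ : 0 < δc) (ha : 0 < a)
    (hρ : a * σc / δc < ρ) (p : ℝ × ℝ) (hpn : 0 ≤ p.1)
    (hp : ρ * δc ≤ Real.sqrt (p.1 ^ 2 + p.2 ^ 2)) :
    let G : ℝ × ℝ → ℝ := fun δ =>
      a * phic σc δc (Real.sqrt (δ.1 ^ 2 + δ.2 ^ 2))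
        - (p.1 * δ.1 + p.2 * δ.2) + (ρ / 2) * (δ.1 ^ 2 + δ.2 ^ 2)
    let δstar : ℝ × ℝ := (p.1 / ρ, p.2 / ρ)
    δc ≤ Real.sqrt (δstar.1 ^ 2 + δstar.2 ^ 2) ∧ 0 ≤ δstar.1 ∧
      ∀ δ : ℝ × ℝ, 0 ≤ δ.1 → δ ≠ δstar → G δstar < G δ := by
  intro G δstar
  have hρ0 : 0 < ρ := lt_trans (by positivity) hρ
  obtain ⟨p1, p2⟩ := p
  obtain ⟨x, hx⟩ : ∃ x, x = p1 / ρ := ⟨_, rfl⟩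
  obtain ⟨y, hy⟩ : ∃ y, y = p2 / ρ := ⟨_, rfl⟩
  have hp1 : p1 = ρ * x := by rw [hx]; field_simp
  have hp2 : p2 = ρ * y := by rw [hy]; field_simp
  have hst : δstar = (x, y) := by simp [δstar, hx, hy]
  clear_value δstar
  subst hst
  have hr : δc ≤ Real.sqrt (x ^ 2 + y ^ 2) := by
    have h : p1 ^ 2 + p2 ^ 2 = ρ ^ 2 * (x ^ 2 + y ^ 2) := by rw [hp1, hp2]; ring
    simp only at hp
    rw [h, Real.sqrt_mul (by positivity), Real.sqrt_sq hρ0.le] at hp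
    exact le_of_mul_le_mul_left hp hρ0
  refine ⟨hr, ?_, ?_⟩
  · simp only at hpn ⊢
    rw [hx]; positivity
  rintro ⟨u, v⟩ - hne
  have hD : 0 < (u - x) ^ 2 + (v - y) ^ 2 := by
    by_contra hcon
    apply hne
    have h1 : (u - x) ^ 2 = 0 := by nlinarith [sq_nonneg (u - x), sq_nonneg (v - y)]
    have h2 : (v - y) ^ 2 = 0 := by nlinarith [sq_nonneg (u - x), sq_nonneg (v - y)]
    have h3 := pow_eq_zero_iff (two_ne_zero) |>.1 h1
    have h4 := pow_eq_zero_iff (two_ne_zero) |>.1 h2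
    ext <;> simp only <;> linarith
  have hr2 : Real.sqrt (x ^ 2 + y ^ 2) ^ 2 = x ^ 2 + y ^ 2 := Real.sq_sqrt (by positivity)
  have ht2 : Real.sqrt (u ^ 2 + v ^ 2) ^ 2 = u ^ 2 + v ^ 2 := Real.sq_sqrt (by positivity)
  have ht0 := Real.sqrt_nonneg (u ^ 2 + v ^ 2)
  simp only [G]
  generalize Real.sqrt (x ^ 2 + y ^ 2) = r at *
  generalize Real.sqrt (u ^ 2 + v ^ 2) = t at *
  have hphi : phic σc δc r = σc * δc / 2 := by
    unfold phic
    split_ifs with h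
    · have : r = δc := le_antisymm h hr
      rw [this]; field_simp; ring
    · rfl
  rw [hphi, hp1, hp2]
  unfold phic
  split_ifs with h
  · obtain ⟨k, hk⟩ : ∃ k, k = a * σc / δc := ⟨_, rfl⟩
    have hk0 : 0 < k := by rw [hk]; positivity
    rw [← hk] at hρ
    have e : a * (σc * t - σc * t ^ 2 / (2 * δc))
        = a * (σc * δc / 2) - k / 2 * (δc - t) ^ 2 := by
      rw [hk]; field_simp; ring
    rw [e]
    have hcs : u * x + v * y ≤ t * r := by
      apply le_of_abs_le
      apply abs_le_of_sq_le_sq _ (mul_nonneg ht0 (hδ.le.trans hr))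
      rw [mul_pow, ht2, hr2]
      nlinarith [sq_nonneg (u * y - v * x)]
    have hDge : (δc - t) ^ 2 ≤ (u - x) ^ 2 + (v - y) ^ 2 := by
      have : (δc - t) ^ 2 ≤ (r - t) ^ 2 := by
        apply pow_le_pow_left₀ <;> linarith
      nlinarith
    have h1 := mul_lt_mul_of_pos_right hρ hD
    have h2 := mul_le_mul_of_nonneg_left hDge hk0.le
    nlinarith
  · have h1 := mul_pos hρ0 hD
    nlinarith
end
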